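/- arXiv:math/0202265 — 2 statements merged into one kernel-verified Lean document; each statement's English description precedes it below -/
import Mathlib

section
/- Let H be a separable, infinite-dimensional complex Hilbert space and let E be a finite-dimensional subspace of H. Then the set of operators A in the positive part of the closed unit ball of B(H) with the property that every nonzero vector of E is cyclic for A is comeager in the positive part of the closed unit ball of B(H) equipped with the relative strong operator topology. -/
open scoped InnerProductSpace ComplexOrder

noncomputable section

/-- The positive part of the closed unit ball of `B(H)`: self-adjoint operators `A` with
`0 ≤ ⟪A v, v⟫ ≤ ‖v‖²` for all `v`. -/
def posUnitBall (H : Type*) [NormedAddCommGroup H] [InnerProductSpace ℂ H]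
    [CompleteSpace H] : Set (H →L[ℂ] H) :=
  {A | IsSelfAdjoint A ∧ ∀ v : H, 0 ≤ ⟪A v, v⟫_ℂ ∧ ⟪A v, v⟫_ℂ ≤ ((‖v‖ ^ 2 : ℝ) : ℂ)}

/-- The relative strong operator topology on the positive part of the unit ball:
the topology of pointwise convergence on `H`. -/
def sot (H : Type*) [NormedAddCommGroup H] [InnerProductSpace ℂ H] [CompleteSpace H] :
    TopologicalSpace (posUnitBall H) :=
  TopologicalSpace.induced (fun A : posUnitBall H => ((A : H →L[ℂ] H) : H → H))
    Pi.topologicalSpace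

open Filter Topology

/-- Every nonzero vector of `E` is cyclic for `A`. -/
def IsCyclicOn {H : Type*} [NormedAddCommGroup H] [InnerProductSpace ℂ H]
    (A : H →L[ℂ] H) (E : Submodule ℂ H) : Prop :=
  ∀ v ∈ E, v ≠ 0 →
    Dense ((Submodule.span ℂ (Set.range fun k : ℕ => (A ^ k) v) : Submodule ℂ H) : Set H)

theorem mem_span_range_pow_iff {H : Type*} [NormedAddCommGroup H] [InnerProductSpace ℂ H]
    (A : H →L[ℂ] H) (v w : H) :
    w ∈ Submodule.span ℂ (Set.range fun k : ℕ => (A ^ k) v) ↔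
      ∃ p : Polynomial ℂ, Polynomial.aeval A p v = w := by
  constructor
  · intro hw
    induction hw using Submodule.span_induction with
    | mem x hx =>
      obtain ⟨k, rfl⟩ := hx
      exact ⟨Polynomial.X ^ k, by simp⟩
    | zero => exact ⟨0, by simp⟩
    | add x y _ _ hx hy =>
      obtain ⟨p, rfl⟩ := hx
      obtain ⟨q, rfl⟩ := hy
      exact ⟨p + q, by simp⟩
    | smul c x _ hx =>
      obtain ⟨p, rfl⟩ := hx
      exact ⟨c • p, by simp⟩
  · rintro ⟨p, rfl⟩
    rw [Polynomial.aeval_eq_sum_range]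
    simp only [FunLike.coe_sum, Finset.sum_apply, smul_apply]
    exact Submodule.sum_mem _ fun k _ =>
      Submodule.smul_mem _ _ (Submodule.subset_span ⟨k, rfl⟩)

theorem norm_le_one_of_mem_posUnitBall {H : Type*} [NormedAddCommGroup H]
    [InnerProductSpace ℂ H] [CompleteSpace H] {A : H →L[ℂ] H} (hA : A ∈ posUnitBall H) :
    ‖A‖ ≤ 1 := by
  have h0 : 0 ≤ A := by
    rw [ContinuousLinearMap.nonneg_iff_isPositive, ContinuousLinearMap.isPositive_iff_complex]
    intro v
    have := (hA.2 v).1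
    rw [Complex.le_def] at this
    exact ⟨Complex.ext (by simp) (by simpa using this.2), by simpa using this.1⟩
  refine (CStarAlgebra.norm_le_one_iff_of_nonneg A h0).2 ?_
  rw [ContinuousLinearMap.le_def, ContinuousLinearMap.isPositive_iff_complex]
  intro v
  have := sub_nonneg.2 (hA.2 v).2
  have h2 : ⟪(1 - A) v, v⟫_ℂ = ((‖v‖ ^ 2 : ℝ) : ℂ) - ⟪A v, v⟫_ℂ := by
    simp [inner_self_eq_norm_sq_to_K]
  rw [← h2, Complex.le_def] at this
  exact ⟨Complex.ext (Complex.ofReal_re _) ((Complex.ofReal_im _).trans this.2), this.1⟩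

section Topology

variable {H X : Type*} [NormedAddCommGroup H] [InnerProductSpace ℂ H] [TopologicalSpace X]
  {φ : X → H →L[ℂ] H}

theorem continuous_aeval_apply (hφ : ∀ v, Continuous fun x => φ x v) (hb : ∀ x, ‖φ x‖ ≤ 1)
    (p : Polynomial ℂ) : Continuous fun y : X × H => Polynomial.aeval (φ y.1) p y.2 := by
  have h1 : Continuous fun y : X × H => φ y.1 y.2 :=
    continuous_prod_of_continuous_lipschitzWith' (fun y : X × H => φ y.1 y.2) 1
      (fun x => (φ x).lipschitz.weaken (hb x)) hφ
  have h2 : ∀ k : ℕ, Continuous fun y : X × H => (φ y.1 ^ k) y.2 := by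
    intro k
    induction k with
    | zero => simpa using continuous_snd
    | succ k ih =>
      simp only [pow_succ', mul_apply_eq_comp]
      exact h1.comp (continuous_fst.prodMk ih)
  simp only [Polynomial.aeval_eq_sum_range, FunLike.coe_sum, Finset.sum_apply,
    smul_apply]
  exact continuous_finsetSum _ fun k _ => (h2 k).const_smul _

theorem isOpen_forall_exists_aeval_norm_lt (hφ : ∀ v, Continuous fun x => φ x v)
    (hb : ∀ x, ‖φ x‖ ≤ 1) {S : Set H} (hS : IsCompact S) (d : H) (ε : ℝ) :
    IsOpen {x | ∀ v ∈ S, ∃ p : Polynomial ℂ, ‖Polynomial.aeval (φ x) p v - d‖ < ε} := by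
  rw [isOpen_iff_eventually]
  intro x hx
  refine hS.eventually_forall_of_forall_eventually fun v hv => ?_
  obtain ⟨p, hp⟩ := hx v hv
  have := ((continuous_aeval_apply hφ hb p).sub continuous_const).norm.continuousAt.eventually_lt
    (continuousAt_const (y := ε)) (x₀ := (x, v)) hp
  exact this.mono fun y hy => ⟨p, hy⟩

/-- Cyclicity of all nonzero vectors of a finite-dimensional subspace is a generic property of a
strongly continuous family of contractions as soon as it holds densely. -/
theorem residual_isCyclicOn [TopologicalSpace.SeparableSpace H]
    (hφ : ∀ v, Continuous fun x => φ x v) (hb : ∀ x, ‖φ x‖ ≤ 1) (E : Submodule ℂ H)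
    [FiniteDimensional ℂ E] (hd : Dense {x | IsCyclicOn (φ x) E}) :
    {x | IsCyclicOn (φ x) E} ∈ residual X := by
  set S : Set H := E.subtype '' Metric.sphere 0 1
  have hS : IsCompact S := by
    have : ProperSpace E := FiniteDimensional.proper ℂ E
    exact (isCompact_sphere _ _).image E.subtypeL.continuous
  set d := TopologicalSpace.denseSeq H
  let U : ℕ × ℕ → Set X := fun i =>
    {x | ∀ v ∈ S, ∃ p : Polynomial ℂ, ‖Polynomial.aeval (φ x) p v - d i.1‖ < 1 / (i.2 + 1 : ℝ)}
  have hU : ∀ i, U i ∈ residual X := by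
    intro i
    refine residual_of_dense_open (isOpen_forall_exists_aeval_norm_lt hφ hb hS _ _)
      (hd.mono fun x hx => ?_)
    rintro _ ⟨v, hv, rfl⟩
    have hv0 : (v : H) ≠ 0 := by
      intro h
      have h' : v = 0 := by exact_mod_cast h
      simp [h'] at hv
    obtain ⟨w, hw, hw'⟩ := (hx v v.2 hv0).exists_dist_lt (d i.1)
      (ε := 1 / (i.2 + 1 : ℝ)) (by positivity)
    obtain ⟨p, rfl⟩ := (mem_span_range_pow_iff _ _ _).1 hw
    exact ⟨p, by rwa [← dist_eq_norm, dist_comm]⟩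
  refine mem_of_superset (countable_iInter_mem.2 hU) fun x hx v hv hv0 => ?_
  rw [Set.mem_iInter] at hx
  rw [dense_iff_closure_eq, ← Set.univ_subset_iff,
    ← (TopologicalSpace.denseRange_denseSeq H).closure_eq]
  refine closure_minimal ?_ isClosed_closure
  rintro _ ⟨i, rfl⟩
  rw [Metric.mem_closure_iff]
  intro ε hε
  obtain ⟨n, hn⟩ := exists_nat_one_div_lt hε
  have hvS : (‖v‖⁻¹ : ℂ) • v ∈ S :=
    ⟨⟨_, E.smul_mem _ hv⟩, by simp [norm_smul, hv0], rfl⟩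
  obtain ⟨p, hp⟩ := hx (i, n) _ hvS
  refine ⟨_, (mem_span_range_pow_iff _ _ _).2 ⟨(‖v‖⁻¹ : ℂ) • p, rfl⟩, ?_⟩
  rw [dist_comm, dist_eq_norm]
  refine lt_trans ?_ hn
  simpa using hp

end Topology

section Jacobi

variable {H : Type*} [NormedAddCommGroup H] [InnerProductSpace ℂ H] [CompleteSpace H]

theorem HilbertBasis.exists_shift (e : HilbertBasis ℕ ℂ H) :
    ∃ S : H →ₗᵢ[ℂ] H, ∀ k, S (e k) = e (k + 1) := by
  have ho : Orthonormal ℂ fun k => e (k + 1) := e.orthonormal.comp _ (add_left_injective 1)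
  refine ⟨ho.orthogonalFamily.linearIsometry.comp e.repr.toLinearIsometry, fun k => ?_⟩
  simp [HilbertBasis.repr_self, OrthogonalFamily.linearIsometry_apply_single]

/-- `T` acts on the orthonormal sequence `e` as the tridiagonal matrix with entries `1/2` on the
diagonal and `1/4` next to it. -/
structure IsFreeJacobi (T : H →L[ℂ] H) (e : ℕ → H) : Prop where
  zero : (4 : ℂ) • T (e 0) = (2 : ℂ) • e 0 + e 1
  succ : ∀ k, (4 : ℂ) • T (e (k + 1)) = e k + (2 : ℂ) • e (k + 1) + e (k + 2)

theorem HilbertBasis.exists_isFreeJacobi (e : HilbertBasis ℕ ℂ H) :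
    ∃ T ∈ posUnitBall H, IsFreeJacobi T e := by
  obtain ⟨S, hS⟩ := e.exists_shift
  set L : H →L[ℂ] H := S.toContinuousLinearMap
  have hL : ∀ k, L (e k) = e (k + 1) := hS
  have hLn : ∀ v, ‖L v‖ = ‖v‖ := S.norm_map
  have hLL : ∀ v, L.adjoint (L v) = v := fun v => by
    refine ext_inner_left ℂ fun w => ?_
    rw [ContinuousLinearMap.adjoint_inner_right]
    exact S.inner_map_map w v
  have hL0 : L.adjoint (e 0) = 0 := by
    have h : ∀ k, ⟪e k, L.adjoint (e 0)⟫_ℂ = 0 := fun k => by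
      rw [ContinuousLinearMap.adjoint_inner_right, hL]
      exact e.orthonormal.2 (Nat.succ_ne_zero k)
    refine e.repr.injective ?_
    ext k
    rw [e.repr_apply_apply, h]
    simp
  set R : H →L[ℂ] H := (2⁻¹ : ℂ) • (1 + L)
  have hR : ∀ v, ‖R v‖ ≤ ‖v‖ := fun v => by
    have h1 : ‖v + L v‖ ≤ ‖v‖ + ‖v‖ := (norm_add_le _ _).trans_eq (by rw [hLn])
    have : ‖R v‖ = 2⁻¹ * ‖v + L v‖ := by
      rw [show R v = (2⁻¹ : ℂ) • (v + L v) by simp [R], norm_smul]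
      simp
    rw [this]
    linarith
  have hT : ∀ v, (4 : ℂ) • (R.adjoint * R) v = (2 : ℂ) • v + L v + L.adjoint v := fun v => by
    refine ext_inner_left ℂ fun w => ?_
    have : ⟪w, v + L v⟫_ℂ + ⟪w, L.adjoint v + v⟫_ℂ
        = ⟪w, (2 : ℂ) • v + L v + L.adjoint v⟫_ℂ := by
      rw [← inner_add_right]
      congr 1
      module
    have h2 : L.adjoint v + v = L.adjoint (v + L v) := by rw [map_add, hLL]
    rw [← this, h2, ContinuousLinearMap.adjoint_inner_right, inner_smul_right, mul_apply_eq_comp,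
      ContinuousLinearMap.adjoint_inner_right]
    simp only [R, smul_apply, add_apply, one_apply_eq_self, inner_smul_left, inner_smul_right,
      inner_add_left, inner_add_right, map_inv₀, map_ofNat]
    ring
  refine ⟨R.adjoint * R, ⟨IsSelfAdjoint.star_mul_self R, fun v => ?_⟩, ⟨?_, fun k => ?_⟩⟩
  · have : ⟪(R.adjoint * R) v, v⟫_ℂ = ((‖R v‖ ^ 2 : ℝ) : ℂ) := by
      rw [mul_apply_eq_comp, ContinuousLinearMap.adjoint_inner_left,
        inner_self_eq_norm_sq_to_K]
      simp
    rw [this]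
    refine ⟨Complex.zero_le_real.2 (sq_nonneg _), ?_⟩
    have h := hR v
    exact_mod_cast pow_le_pow_left₀ (norm_nonneg _) h 2
  · rw [hT, hL0, hL, add_zero]
  · rw [hT, hL]
    nth_rw 3 [← hL]
    rw [hLL]
    module

/-- A free Jacobi operator has no eigenvalue. -/
theorem IsFreeJacobi.eq_zero_of_apply_eq_smul {T : H →L[ℂ] H} {e : HilbertBasis ℕ ℂ H}
    (hT : T ∈ posUnitBall H) (h : IsFreeJacobi T e) {v : H} {c : ℂ} (hv : T v = c • v) :
    v = 0 := by
  have hsym : ∀ k, ⟪(4 : ℂ) • T (e k), v⟫_ℂ = 4 * c * ⟪e k, v⟫_ℂ := fun k => by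
    rw [inner_smul_left, ← ContinuousLinearMap.adjoint_inner_right, hT.1.adjoint_eq, hv,
      inner_smul_right]
    rw [map_ofNat, mul_assoc]
  set a : ℕ → ℂ := fun k => ⟪e k, v⟫_ℂ
  have ha0 : a 1 = (4 * c - 2) * a 0 := by
    have := hsym 0
    rw [h.zero, inner_add_left, inner_smul_left, map_ofNat] at this
    linear_combination this
  have has : ∀ k, a (k + 2) = (4 * c - 2) * a (k + 1) - a k := fun k => by
    have := hsym (k + 1)
    rw [h.succ, inner_add_left, inner_add_left, inner_smul_left, map_ofNat] at this
    linear_combination this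
  have hQ : ∀ k, a (k + 1) ^ 2 - (4 * c - 2) * (a k * a (k + 1)) + a k ^ 2 = a 0 ^ 2 := by
    intro k
    induction k with
    | zero => rw [zero_add, ha0]; ring
    | succ k ih => rw [← ih, has]; ring
  have hlim : Tendsto a atTop (𝓝 0) := by
    have h1 := (e.orthonormal.inner_products_summable v).tendsto_atTop_zero
    rw [tendsto_zero_iff_norm_tendsto_zero]
    have h2 := h1.sqrt
    simpa [Real.sqrt_sq] using h2
  have hlim' := hlim.comp (tendsto_add_atTop_nat 1)
  have h0 : a 0 ^ 2 = 0 := by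
    have h1 := ((hlim'.pow 2).sub ((hlim.mul hlim').const_mul (4 * c - 2))).add (hlim.pow 2)
    have h2 : Tendsto (fun _ : ℕ => a 0 ^ 2) atTop (𝓝 0) := by
      convert h1 using 2
      · exact (hQ _).symm
      · simp
    exact tendsto_nhds_unique tendsto_const_nhds h2
  have h0' : a 0 = 0 := by simpa using h0
  have hall : ∀ k, a k = 0 ∧ a (k + 1) = 0 := by
    intro k
    induction k with
    | zero => exact ⟨h0', by rw [ha0, h0', mul_zero]⟩
    | succ k ih => exact ⟨ih.2, by rw [has, ih.1, ih.2]; ring⟩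
  refine e.repr.injective ?_
  ext k
  rw [e.repr_apply_apply]
  simpa using (hall k).1

theorem denseRange_sub_algebraMap {T : H →L[ℂ] H} (hT : IsSelfAdjoint T)
    (hinj : ∀ (c : ℂ) (v : H), T v = c • v → v = 0) (c : ℂ) :
    DenseRange (T - algebraMap ℂ (H →L[ℂ] H) c) := by
  have h : (LinearMap.range (T - algebraMap ℂ (H →L[ℂ] H) c).toLinearMap).topologicalClosure
      = ⊤ := by
    rw [Submodule.topologicalClosure_eq_top_iff, Submodule.eq_bot_iff]
    intro w hw
    refine hinj (starRingEnd ℂ c) w (ext_inner_left ℂ fun x => ?_)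
    have := hw _ ⟨x, rfl⟩
    rw [← hT.adjoint_eq, ContinuousLinearMap.adjoint_inner_right, inner_smul_right]
    simpa [inner_sub_left, inner_smul_left, sub_eq_zero, Algebra.algebraMap_eq_smul_one] using this
  have h' := Submodule.dense_iff_topologicalClosure_eq_top.2 h
  exact h'

theorem denseRange_aeval {T : H →L[ℂ] H} (hT : IsSelfAdjoint T)
    (hinj : ∀ (c : ℂ) (v : H), T v = c • v → v = 0) {p : Polynomial ℂ} (hp : p ≠ 0) :
    DenseRange (Polynomial.aeval T p) := by
  have key : ∀ s : Multiset ℂ, DenseRange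
      (Polynomial.aeval T (s.map fun a => Polynomial.X - Polynomial.C a).prod) := by
    intro s
    induction s using Multiset.induction_on with
    | empty => simpa using Function.surjective_id.denseRange
    | cons a s ih =>
      rw [Multiset.map_cons, Multiset.prod_cons, map_mul]
      have := (denseRange_sub_algebraMap hT hinj a).comp ih (ContinuousLinearMap.continuous _)
      simpa using this
  rw [(IsAlgClosed.splits p).eq_prod_roots, map_mul, Polynomial.aeval_C]
  have hs : Function.Surjective (algebraMap ℂ (H →L[ℂ] H) p.leadingCoeff) := fun v =>
    ⟨p.leadingCoeff⁻¹ • v, by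
      simp [Algebra.algebraMap_eq_smul_one, smul_smul, Polynomial.leadingCoeff_ne_zero.2 hp]⟩
  exact hs.denseRange.comp (key _) (ContinuousLinearMap.continuous _)

/-- Every nonzero finite linear combination of the basis is cyclic for a free Jacobi operator. -/
theorem IsFreeJacobi.isCyclicOn_span {T : H →L[ℂ] H} {e : HilbertBasis ℕ ℂ H}
    (hT : T ∈ posUnitBall H) (h : IsFreeJacobi T e) :
    IsCyclicOn T (Submodule.span ℂ (Set.range e)) := by
  intro v hv hv0
  set D := Submodule.span ℂ (Set.range fun k : ℕ => (T ^ k) (e 0))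
  have hTD : ∀ w ∈ D, T w ∈ D := by
    intro w hw
    obtain ⟨p, rfl⟩ := (mem_span_range_pow_iff _ _ _).1 hw
    exact (mem_span_range_pow_iff _ _ _).2 ⟨Polynomial.X * p, by simp⟩
  have heD : ∀ k, e k ∈ D ∧ e (k + 1) ∈ D := by
    intro k
    induction k with
    | zero =>
      have h0 : e 0 ∈ D := Submodule.subset_span ⟨0, by simp⟩
      have h1 : e 1 = (4 : ℂ) • T (e 0) - (2 : ℂ) • e 0 := by rw [h.zero]; module
      exact ⟨h0, by
        rw [zero_add, h1]
        exact D.sub_mem (D.smul_mem _ (hTD _ h0)) (D.smul_mem _ h0)⟩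
    | succ k ih =>
      have h1 : e (k + 2) = (4 : ℂ) • T (e (k + 1)) - (2 : ℂ) • e (k + 1) - e k := by
        rw [h.succ]; module
      exact ⟨ih.2, by
        rw [h1]
        exact D.sub_mem (D.sub_mem (D.smul_mem _ (hTD _ ih.2)) (D.smul_mem _ ih.2)) ih.1⟩
  have hle : Submodule.span ℂ (Set.range e) ≤ D := by
    rw [Submodule.span_le]
    rintro _ ⟨k, rfl⟩
    exact (heD k).1
  have hD : Dense (D : Set H) :=
    (Submodule.dense_iff_topologicalClosure_eq_top.2 e.dense_span).mono hle
  obtain ⟨p, rfl⟩ := (mem_span_range_pow_iff _ _ _).1 (hle hv)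
  have hp : p ≠ 0 := by
    rintro rfl
    simp at hv0
  refine ((denseRange_aeval hT.1 (fun c v => h.eq_zero_of_apply_eq_smul hT) hp).dense_image
    (ContinuousLinearMap.continuous _) hD).mono ?_
  rintro _ ⟨w, hw, rfl⟩
  obtain ⟨q, rfl⟩ := (mem_span_range_pow_iff _ _ _).1 hw
  refine (mem_span_range_pow_iff _ _ _).2 ⟨q, ?_⟩
  rw [← mul_apply_eq_comp, ← mul_apply_eq_comp, ← map_mul, ← map_mul, mul_comm]

end Jacobi

section Basis

variable {H : Type*} [NormedAddCommGroup H] [InnerProductSpace ℂ H]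

theorem Orthonormal.countable [TopologicalSpace.SeparableSpace H] {ι : Type*} {v : ι → H}
    (hv : Orthonormal ℂ v) : Countable ι := by
  refine Pairwise.countable_of_isOpen_disjoint (s := fun i => Metric.ball (v i) (1 / 2))
    (fun i j hij => Metric.ball_disjoint_ball ?_) (fun _ => Metric.isOpen_ball)
    (fun _ => Metric.nonempty_ball.2 (by norm_num))
  have h := norm_sub_sq (𝕜 := ℂ) (v i) (v j)
  rw [hv.2 hij, hv.1, hv.1] at h
  rw [dist_eq_norm]
  norm_num at h
  nlinarith [norm_nonneg (v i - v j)]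

/-- A finite orthonormal family is the beginning of a Hilbert basis indexed by `ℕ`. -/
theorem Orthonormal.exists_hilbertBasis_nat [CompleteSpace H]
    [TopologicalSpace.SeparableSpace H] (hinf : ¬ FiniteDimensional ℂ H) {n : ℕ}
    {u : Fin n → H} (hu : Orthonormal ℂ u) :
    ∃ b : HilbertBasis ℕ ℂ H, ∀ i : Fin n, b i = u i := by
  obtain ⟨w, b, hw, hb⟩ := hu.toSubtypeRange.exists_hilbertBasis_extension
  have hwo : Orthonormal ℂ ((↑) : w → H) := hb ▸ b.orthonormal
  have hwc : Countable w := hwo.countable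
  have hwi : Infinite w := by
    rw [← not_finite_iff_infinite]
    intro hfin
    have : Fintype w := Fintype.ofFinite w
    exact hinf b.toOrthonormalBasis.toBasis.finiteDimensional_of_finite
  have : Denumerable w := Classical.choice (nonempty_denumerable w)
  let f : {k : ℕ | k < n} ↪ w :=
    ⟨fun k => ⟨u ⟨k, k.2⟩, hw ⟨_, rfl⟩⟩, fun k l hkl => by
      have := hu.linearIndependent.injective (congrArg Subtype.val hkl)
      exact Subtype.ext (by simpa using this)⟩
  obtain ⟨g, hg⟩ := Cardinal.extend_function_of_lt f
    (by
      rw [Cardinal.mk_nat]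
      exact (Set.finite_lt_nat n).lt_aleph0)
    ⟨(Denumerable.eqv w).symm⟩
  refine ⟨.mk (v := fun k => (g k : H)) (hwo.comp g g.injective) ?_, fun i => ?_⟩
  · have h : Set.range (fun k => (g k : H)) = Set.range b := by
      rw [hb]
      exact g.surjective.range_comp ((↑) : w → H)
    rw [h, b.dense_span]
  · rw [HilbertBasis.coe_mk]
    exact congrArg Subtype.val (hg ⟨i, i.2⟩)

/-- The normalized wave `N ^ (-1/2) ∑ k < N, z ^ k e (s + k + 1)`. -/
def wave (e : ℕ → H) (N s : ℕ) (z : ℂ) : H :=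
  (((√N)⁻¹ : ℝ) : ℂ) • ∑ k ∈ Finset.range N, z ^ k • e (s + k + 1)

theorem wave_mem_span (e : ℕ → H) (N s : ℕ) (z : ℂ) :
    wave e N s z ∈ Submodule.span ℂ (Set.range e) :=
  Submodule.smul_mem _ _ <| Submodule.sum_mem _ fun _ _ =>
    Submodule.smul_mem _ _ (Submodule.subset_span ⟨_, rfl⟩)

theorem orthonormal_wave {e : ℕ → H} (he : Orthonormal ℂ e) {n N : ℕ} (hN : N ≠ 0)
    {z : Fin n → ℂ} (hz : ∀ i, ‖z i‖ = 1) :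
    Orthonormal ℂ fun i : Fin n => wave e N (N * i) (z i) := by
  rw [orthonormal_iff_ite]
  intro i j
  have hN' : (√N : ℂ) * √N = N := by
    rw [← Complex.ofReal_mul, Real.mul_self_sqrt (Nat.cast_nonneg N), Complex.ofReal_natCast]
  have hN0 : (√N : ℂ) ≠ 0 := by
    intro h
    rw [h, zero_mul] at hN'
    exact hN (by exact_mod_cast hN'.symm)
  have hterm : ∀ k ∈ Finset.range N, ∀ l ∈ Finset.range N,
      ⟪z i ^ k • e (N * i + k + 1), z j ^ l • e (N * j + l + 1)⟫_ℂ
        = if i = j ∧ k = l then 1 else 0 := by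
    intro k hk l hl
    rw [Finset.mem_range] at hk hl
    have hiff : N * (i : ℕ) + k + 1 = N * j + l + 1 ↔ i = j ∧ k = l := by
      refine ⟨fun h => ?_, fun h => by rw [h.1, h.2]⟩
      have h' : N * (i : ℕ) + k = N * j + l := by omega
      have hdiv := congrArg (· / N) h'
      simp only [Nat.mul_add_div (Nat.pos_of_ne_zero hN), Nat.div_eq_of_lt hk,
        Nat.div_eq_of_lt hl, add_zero] at hdiv
      exact ⟨Fin.ext hdiv, by rw [hdiv] at h'; omega⟩
    rw [inner_smul_left, inner_smul_right, orthonormal_iff_ite.1 he]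
    simp only [hiff]
    split_ifs with h
    · rw [h.1, h.2, mul_one, Complex.conj_mul', norm_pow, hz]
      simp
    · simp
  rw [wave, wave, inner_smul_left, inner_smul_right, sum_inner,
    Finset.sum_congr rfl fun k hk => (inner_sum _ _ _).trans (Finset.sum_congr rfl (hterm k hk))]
  by_cases hij : i = j
  · have h1 : ∀ k ∈ Finset.range N,
        ∑ l ∈ Finset.range N, (if i = j ∧ k = l then (1 : ℂ) else 0) = 1 := fun k hk => by
      simpa [hij] using hk
    rw [Finset.sum_congr rfl h1, if_pos hij]
    simp only [Complex.ofReal_inv, map_inv₀, Complex.conj_ofReal, Finset.sum_const,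
      Finset.card_range, nsmul_eq_mul, mul_one]
    rw [← hN']
    field_simp
  · simp [hij]

/-- A finite orthonormal family consists of waves with disjoint supports in some Hilbert basis. -/
theorem Orthonormal.exists_hilbertBasis_wave [CompleteSpace H]
    [TopologicalSpace.SeparableSpace H] (hinf : ¬ FiniteDimensional ℂ H) {n N : ℕ} (hN : N ≠ 0)
    {u : Fin n → H} (hu : Orthonormal ℂ u) {z : Fin n → ℂ} (hz : ∀ i, ‖z i‖ = 1) :
    ∃ e : HilbertBasis ℕ ℂ H, ∀ i : Fin n, u i = wave e N (N * i) (z i) := by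
  have h0 : Orthonormal ℂ (Fin.elim0 : Fin 0 → H) := ⟨fun i => i.elim0, fun i => i.elim0⟩
  obtain ⟨e, -⟩ := h0.exists_hilbertBasis_nat hinf
  obtain ⟨b, hb⟩ := hu.exists_hilbertBasis_nat hinf
  obtain ⟨c, hc⟩ := (orthonormal_wave e.orthonormal hN hz).exists_hilbertBasis_nat hinf
  let V : H ≃ₗᵢ[ℂ] H := c.repr.trans b.repr.symm
  have hV : ∀ k, V (c k) = b k := fun k => by
    simp [V, HilbertBasis.repr_self, HilbertBasis.repr_symm_single]
  refine ⟨.ofRepr (V.symm.trans e.repr), fun i => ?_⟩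
  have hE : ∀ k, (HilbertBasis.ofRepr (V.symm.trans e.repr)) k = V (e k) := fun k => by
    rw [← HilbertBasis.repr_symm_single, ← HilbertBasis.repr_symm_single]
    rfl
  rw [← hb, ← hV, hc]
  simp [wave, hE]

/-- Long waves are approximate eigenvectors of a free Jacobi operator. -/
theorem IsFreeJacobi.norm_apply_wave_sub_le {T : H →L[ℂ] H} {e : ℕ → H}
    (h : IsFreeJacobi T e) (he : ∀ k, ‖e k‖ = 1) {z : ℂ} (hz : ‖z‖ = 1) {c : ℂ}
    (hc : 4 * c = 2 + z + z⁻¹) (N s : ℕ) :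
    ‖T (wave e N s z) - c • wave e N s z‖ ≤ (√N)⁻¹ := by
  have hz0 : z ≠ 0 := by
    rintro rfl
    simp at hz
  set w := ∑ k ∈ Finset.range N, z ^ k • e (s + k + 1) with hw
  have h1 : ∑ k ∈ Finset.range N, z ^ k • e (s + k) = z • w + (e s - z ^ N • e (s + N)) := by
    have := Finset.sum_range_succ (fun k => z ^ k • e (s + k)) N
    rw [Finset.sum_range_succ'] at this
    rw [← sub_eq_iff_eq_add.2 this, hw, Finset.smul_sum]
    simp only [smul_smul, ← pow_succ', pow_zero, one_smul, add_zero, ← add_assoc]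
    abel
  have h2 : ∑ k ∈ Finset.range N, z ^ k • e (s + k + 2)
      = z⁻¹ • (w + (z ^ N • e (s + N + 1) - e (s + 1))) := by
    rw [eq_inv_smul_iff₀ hz0]
    have := Finset.sum_range_succ (fun k => z ^ k • e (s + k + 1)) N
    rw [Finset.sum_range_succ'] at this
    rw [Finset.smul_sum, hw, ← add_sub_assoc, ← this]
    simp only [smul_smul, ← pow_succ', pow_zero, one_smul, add_zero, ← add_assoc]
    exact (add_sub_cancel_right _ _).symm
  have h4 : (4 : ℂ) • T w = (2 + z + z⁻¹) • w + ((e s - z ^ N • e (s + N))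
      + z⁻¹ • (z ^ N • e (s + N + 1) - e (s + 1))) := by
    have : (4 : ℂ) • T w = ∑ k ∈ Finset.range N, z ^ k • e (s + k) + (2 : ℂ) • w
        + ∑ k ∈ Finset.range N, z ^ k • e (s + k + 2) := by
      rw [hw, map_sum, Finset.smul_sum, Finset.smul_sum, ← Finset.sum_add_distrib,
        ← Finset.sum_add_distrib]
      refine Finset.sum_congr rfl fun k _ => ?_
      rw [map_smul, smul_comm, h.succ]
      module
    rw [this, h1, h2]
    module
  have h5 : (4 : ℂ) • (T w - c • w) = (e s - z ^ N • e (s + N))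
      + z⁻¹ • (z ^ N • e (s + N + 1) - e (s + 1)) := by
    rw [smul_sub, h4, smul_smul, hc]
    abel
  have h6 : ‖T w - c • w‖ ≤ 1 := by
    have ha : ‖(4 : ℂ) • (T w - c • w)‖ ≤ 4 := by
      rw [h5]
      refine (norm_add_le _ _).trans ?_
      rw [norm_smul, norm_inv, hz, inv_one, one_mul]
      have h7 := norm_sub_le (e s) (z ^ N • e (s + N))
      have h8 := norm_sub_le (z ^ N • e (s + N + 1)) (e (s + 1))
      simp only [norm_smul, norm_pow, hz, one_pow, he] at h7 h8
      linarith
    rw [norm_smul] at ha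
    norm_num at ha
    linarith
  have h9 : T (wave e N s z) - c • wave e N s z = (((√N)⁻¹ : ℝ) : ℂ) • (T w - c • w) := by
    rw [wave, map_smul, smul_sub, smul_comm c]
  rw [h9, norm_smul, Complex.norm_real, Real.norm_of_nonneg (by positivity)]
  exact mul_le_of_le_one_right (by positivity) h6

end Basis

section Density

theorem exists_norm_one_add_inv {t : ℝ} (h0 : 0 ≤ t) (h1 : t ≤ 1) :
    ∃ z : ℂ, ‖z‖ = 1 ∧ 4 * (t : ℂ) = 2 + z + z⁻¹ := by
  refine ⟨Complex.exp (Real.arccos (2 * t - 1) * Complex.I), Complex.norm_exp_ofReal_mul_I _, ?_⟩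
  have h := Complex.two_cos (Real.arccos (2 * t - 1) : ℂ)
  rw [← Complex.ofReal_cos, Real.cos_arccos (by linarith) (by linarith)] at h
  rw [← Complex.exp_neg, ← neg_mul, add_assoc, ← h]
  push_cast
  ring

variable {H : Type*} [NormedAddCommGroup H] [InnerProductSpace ℂ H] [CompleteSpace H]

theorem exists_orthonormalBasis_eigenvectors {A : H →L[ℂ] H} (hA : A ∈ posUnitBall H)
    (F : Submodule ℂ H) [FiniteDimensional ℂ F] :
    ∃ (n : ℕ) (u : OrthonormalBasis (Fin n) ℂ F) (t : Fin n → ℝ),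
      (∀ i, 0 ≤ t i ∧ t i ≤ 1) ∧
      ∀ x : F, A x ∈ F → A x = ∑ i, u.repr x i • (t i : ℂ) • (u i : H) := by
  let B : F →ₗ[ℂ] F := (F.orthogonalProjectionOnto ∘L A ∘L F.subtypeL).toLinearMap
  have hBA : ∀ x y : F, ⟪B x, y⟫_ℂ = ⟪A x, (y : H)⟫_ℂ := fun x y => by
    simp [B]
  have hAs : ∀ x y : H, ⟪A x, y⟫_ℂ = ⟪x, A y⟫_ℂ := fun x y => by
    rw [← ContinuousLinearMap.adjoint_inner_right, hA.1.adjoint_eq]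
  have hB : B.IsSymmetric := fun x y => by
    rw [hBA, hAs, ← inner_conj_symm x, hBA, inner_conj_symm]
  let u := hB.eigenvectorBasis rfl
  let t := hB.eigenvalues rfl
  have hu : ∀ i, B (u i) = (t i : ℂ) • u i := hB.apply_eigenvectorBasis rfl
  refine ⟨_, u, t, fun i => ?_, fun x hx => ?_⟩
  · have h1 : ⟪A (u i), (u i : H)⟫_ℂ = (t i : ℂ) := by
      rw [← hBA, hu, inner_smul_left, inner_self_eq_norm_sq_to_K, u.orthonormal.1]
      simp
    have h2 := hA.2 (u i)
    have h3 : ‖(u i : H)‖ = 1 := u.orthonormal.1 i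
    rw [h1, h3] at h2
    exact ⟨by exact_mod_cast h2.1, by simpa using (Complex.real_le_real (y := 1 ^ 2)).1 h2.2⟩
  · have h1 : A x = (B x : H) := by
      simp only [B]
      exact (F.starProjection_eq_self_iff.2 hx).symm
    have h2 : B x = ∑ i, u.repr x i • (t i : ℂ) • u i := by
      conv_lhs => rw [← u.sum_repr x, map_sum]
      exact Finset.sum_congr rfl fun i _ => by rw [map_smul, hu]
    rw [h1, h2]
    simp

/-- A positive contraction can be approximated on finitely many vectors by positive contractions
for which all nonzero vectors of a given finite-dimensional subspace are cyclic. -/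
theorem exists_isCyclicOn_norm_sub_le [TopologicalSpace.SeparableSpace H]
    (hinf : ¬ FiniteDimensional ℂ H) {A : H →L[ℂ] H} (hA : A ∈ posUnitBall H)
    (F : Submodule ℂ H) [FiniteDimensional ℂ F] {ε : ℝ} (hε : 0 < ε) :
    ∃ T ∈ posUnitBall H, IsCyclicOn T F ∧ ∀ x ∈ F, A x ∈ F → ‖T x - A x‖ ≤ ε * ‖x‖ := by
  obtain ⟨n, u, t, ht, hu⟩ := exists_orthonormalBasis_eigenvectors hA F
  choose z hz hzt using fun i => exists_norm_one_add_inv (ht i).1 (ht i).2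
  have huo : Orthonormal ℂ fun i => (u i : H) := u.orthonormal.comp_linearIsometry F.subtypeₗᵢ
  obtain ⟨N, hN, hNε⟩ : ∃ N : ℕ, N ≠ 0 ∧ n * (√N)⁻¹ ≤ ε := by
    have h : Tendsto (fun N : ℕ => n * (√N)⁻¹) atTop (𝓝 (n * 0)) :=
      ((tendsto_inv_atTop_zero.comp Real.tendsto_sqrt_atTop).comp
        tendsto_natCast_atTop_atTop).const_mul _
    rw [mul_zero] at h
    obtain ⟨N, hN, hN'⟩ := ((eventually_ne_atTop 0).and (h.eventually_le_const hε)).exists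
    exact ⟨N, hN, hN'⟩
  obtain ⟨e, he⟩ := huo.exists_hilbertBasis_wave hinf hN hz
  obtain ⟨T, hT, hTe⟩ := e.exists_isFreeJacobi
  have hsum : ∀ x : F, (x : H) = ∑ i, u.repr x i • (u i : H) := fun x => by
    conv_lhs => rw [← u.sum_repr x]
    simp
  refine ⟨T, hT, fun v hv => hTe.isCyclicOn_span hT v ?_, fun x hx hAx => ?_⟩
  · have h := hsum ⟨v, hv⟩
    simp only at h
    rw [h]
    refine Submodule.sum_mem _ fun i _ => Submodule.smul_mem _ _ ?_
    rw [he]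
    exact wave_mem_span _ _ _ _
  · have h1 : T x - A x = ∑ i, u.repr ⟨x, hx⟩ i • (T (u i) - (t i : ℂ) • (u i : H)) := by
      have h2 := hu ⟨x, hx⟩ hAx
      simp only [smul_sub, Finset.sum_sub_distrib]
      rw [← h2]
      congr 1
      conv_lhs => rw [show x = _ from hsum ⟨x, hx⟩, map_sum]
      simp only [map_smul]
    have h3 : ∀ i, ‖u.repr ⟨x, hx⟩ i • (T (u i) - (t i : ℂ) • (u i : H))‖ ≤ ‖x‖ * (√N)⁻¹ := by
      intro i
      rw [norm_smul]
      refine mul_le_mul ?_ ?_ (norm_nonneg _) (norm_nonneg _)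
      · refine (PiLp.norm_apply_le _ i).trans_eq ?_
        rw [u.repr.norm_map]
        rfl
      · rw [he]
        exact hTe.norm_apply_wave_sub_le e.orthonormal.1 (hz i) (hzt i) _ _
    rw [h1]
    refine (norm_sum_le_of_le _ fun i _ => h3 i).trans ?_
    rw [Finset.sum_const, Finset.card_univ, Fintype.card_fin, nsmul_eq_mul]
    nlinarith [mul_le_mul_of_nonneg_left hNε (norm_nonneg x)]

end Density

/-- Let `H` be a separable, infinite-dimensional complex Hilbert space and `E` a
finite-dimensional subspace of `H`.  Then the set of operators in the positive part of the
closed unit ball of `B(H)` for which every nonzero vector of `E` is cyclic is comeager for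
the relative strong operator topology. -/
theorem comeager_cyclic_of_finiteDimensional (H : Type*) [NormedAddCommGroup H]
    [InnerProductSpace ℂ H] [CompleteSpace H] [TopologicalSpace.SeparableSpace H]
    (hinf : ¬ FiniteDimensional ℂ H) (E : Submodule ℂ H) [FiniteDimensional ℂ E] :
    {A : posUnitBall H | ∀ v ∈ E, v ≠ 0 →
        Dense ((Submodule.span ℂ
          (Set.range fun k : ℕ => ((A : H →L[ℂ] H) ^ k) v) : Submodule ℂ H) : Set H)}
      ∈ @residual (posUnitBall H) (sot H) := by
  let τ : TopologicalSpace (posUnitBall H) := sot H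
  have hind : @Topology.IsInducing _ _ τ _ fun A : posUnitBall H =>
      ((A : H →L[ℂ] H) : H → H) := ⟨rfl⟩
  refine @residual_isCyclicOn H (posUnitBall H) _ _ τ (fun A => A) _
    (fun v => (continuous_apply v).comp hind.continuous)
    (fun A => norm_le_one_of_mem_posUnitBall A.2) E _ ?_
  refine (@dense_iff_inter_open _ τ _).2 fun U hU ⟨A, hAU⟩ => ?_
  obtain ⟨V, hV, rfl⟩ := hind.isOpen_iff.1 hU
  obtain ⟨I, W, hW, hWV⟩ := isOpen_pi_iff.1 hV _ hAU
  let F : Submodule ℂ H := E ⊔ Submodule.span ℂ (I : Set H) ⊔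
    Submodule.span ℂ ((A : H →L[ℂ] H) '' (I : Set H))
  have hF1 : FiniteDimensional ℂ (Submodule.span ℂ (I : Set H)) :=
    FiniteDimensional.span_of_finite ℂ I.finite_toSet
  have hF2 : FiniteDimensional ℂ (Submodule.span ℂ ((A : H →L[ℂ] H) '' (I : Set H))) :=
    FiniteDimensional.span_of_finite ℂ (I.finite_toSet.image _)
  have hF : FiniteDimensional ℂ F := inferInstance
  choose! T hT hTF hTA using fun ε (hε : 0 < ε) =>
    exists_isCyclicOn_norm_sub_le hinf A.2 F (ε := ε) hε
  have hlim : ∀ x ∈ I, Tendsto (fun ε => T ε x) (𝓝[>] 0) (𝓝 ((A : H →L[ℂ] H) x)) := by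
    intro x hx
    have hxF : x ∈ F := (le_sup_right.trans le_sup_left : _ ≤ F) (Submodule.subset_span hx)
    have hAxF : (A : H →L[ℂ] H) x ∈ F :=
      (le_sup_right : _ ≤ F) (Submodule.subset_span ⟨x, hx, rfl⟩)
    rw [tendsto_iff_norm_sub_tendsto_zero]
    have h0 : Tendsto (fun ε : ℝ => ε * ‖x‖) (𝓝[>] 0) (𝓝 0) := by
      have : Tendsto (fun ε : ℝ => ε * ‖x‖) (𝓝 0) (𝓝 (0 * ‖x‖)) := tendsto_id.mul_const _
      rw [zero_mul] at this
      exact this.mono_left nhdsWithin_le_nhds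
    refine tendsto_of_tendsto_of_tendsto_of_le_of_le' tendsto_const_nhds h0
      (Eventually.of_forall fun _ => norm_nonneg _) ?_
    filter_upwards [self_mem_nhdsWithin] with ε hε using hTA ε hε x hxF hAxF
  have hev : ∀ᶠ ε in 𝓝[>] (0 : ℝ), ∀ x ∈ I, T ε x ∈ W x :=
    (Finset.eventually_all I).2 fun x hx =>
      (hlim x hx).eventually ((hW x hx).1.mem_nhds (hW x hx).2)
  obtain ⟨ε, hεW, hε⟩ := (hev.and self_mem_nhdsWithin).exists
  exact ⟨⟨T ε, hT ε hε⟩, hWV hεW, fun v hv =>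
    hTF ε hε v ((le_sup_left.trans le_sup_left : E ≤ F) hv)⟩
end
end

section
/- Let P be the set of pairs (E, T), where E is a finite-dimensional subspace of the complex Hilbert space ℓ² = ℓ²(ℕ), T : E → ℓ² is a linear map with operator norm ‖T‖ < 1, and the only subspace E′ ⊆ E with T(E′) ⊆ E′ is E′ = {0}; order P by reverse inclusion, i.e. (E, T) ≤ (F, S) iff F ⊆ E and T restricted to F equals S. For unit vectors v, w ∈ ℓ², let D_{v,w} be the set of (E, T) ∈ P such that there exists n ≥ 1 with v ∈ E, Tv ∈ E, ..., Tⁿ⁻¹v ∈ E and ⟨Tⁿv, w⟩ ≠ 0, and let D = {D_{v,w} : v, w ∈ ℓ², ‖v‖ = ‖w‖ = 1}. Then there exists a bounded linear operator A on ℓ² whose only closed invariant subspaces are {0} and ℓ² if and only if there exists a filter G on P that intersects every member of D. -/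
open scoped InnerProductSpace

noncomputable section

/-- The complex Hilbert space `ℓ² = ℓ²(ℕ)`. -/
abbrev l2 : Type := lp (fun _ : ℕ => ℂ) 2

/-- The poset `P` of partially defined operators on `ℓ²`: pairs `(E, T)` where `E` is a
finite-dimensional subspace of `ℓ²`, `T : E → ℓ²` is linear with `‖T‖ < 1`, and the only
subspace `E' ⊆ E` with `T(E') ⊆ E'` is `{0}`. -/
structure PartialOp where
  /-- the (finite-dimensional) domain -/
  dom : Submodule ℂ l2
  findim : FiniteDimensional ℂ dom
  /-- the operator, defined on the domain -/
  toFun : dom →L[ℂ] l2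
  norm_lt : ‖toFun‖ < 1
  no_invariant : ∀ E' : Submodule ℂ dom,
    (∀ x ∈ E', toFun x ∈ E'.map dom.subtype) → E' = ⊥

/-- The order on `P`: reverse inclusion of partial operators, i.e. `(E, T) ≤ (F, S)` iff
`F ⊆ E` and `T` restricted to `F` equals `S`. -/
def PartialOp.le (p q : PartialOp) : Prop :=
  q.dom ≤ p.dom ∧
    ∀ (x : l2) (hq : x ∈ q.dom) (hp : x ∈ p.dom), p.toFun ⟨x, hp⟩ = q.toFun ⟨x, hq⟩

/-- For unit vectors `v, w ∈ ℓ²`, the set `D_{v,w}` of `(E, T) ∈ P` such that for some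
`n ≥ 1` the iterates `v, Tv, …, Tⁿ⁻¹v` all lie in `E` and `⟪Tⁿ v, w⟫ ≠ 0`. -/
def Dvw (v w : l2) : Set PartialOp :=
  {p | ∃ n : ℕ, 1 ≤ n ∧ ∃ u : ℕ → l2, u 0 = v ∧
    (∀ k < n, ∃ h : u k ∈ p.dom, u (k + 1) = p.toFun ⟨u k, h⟩) ∧ ⟪u n, w⟫_ℂ ≠ 0}

theorem not_finiteDimensional_l2 : ¬ FiniteDimensional ℂ l2 := by
  intro h
  have hli := (HilbertBasis.ofRepr (LinearIsometryEquiv.refl ℂ l2)).orthonormal.linearIndependent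
  exact not_finite_iff_infinite.mpr inferInstance hli.finite_of_isNoetherian

/-- `A` has no closed invariant subspace besides `{0}` and the whole space. -/
def HasOnlyTrivialInvariant (A : l2 →L[ℂ] l2) : Prop :=
  ∀ E : Submodule ℂ l2, IsClosed (E : Set l2) → (∀ x ∈ E, A x ∈ E) → E = ⊥ ∨ E = ⊤

namespace HasOnlyTrivialInvariant

variable {A : l2 →L[ℂ] l2}

theorem smul (hA : HasOnlyTrivialInvariant A) {c : ℂ} (hc : c ≠ 0) :
    HasOnlyTrivialInvariant (c • A) := fun E hE hinv =>
  hA E hE fun x hx => by simpa [smul_smul, hc] using E.smul_mem c⁻¹ (hinv x hx)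

theorem exists_norm_lt_one (hA : HasOnlyTrivialInvariant A) :
    ∃ B : l2 →L[ℂ] l2, HasOnlyTrivialInvariant B ∧ ‖B‖ < 1 := by
  have hpos : 0 < ‖A‖ + 1 := by positivity
  refine ⟨((‖A‖ + 1 : ℝ) : ℂ)⁻¹ • A, hA.smul (by exact_mod_cast (inv_pos.mpr hpos).ne'), ?_⟩
  rw [norm_smul, norm_inv, Complex.norm_real, Real.norm_of_nonneg hpos.le, inv_mul_lt_iff₀ hpos]
  linarith

theorem eq_bot_of_finiteDimensional (hA : HasOnlyTrivialInvariant A) (E : Submodule ℂ l2)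
    [FiniteDimensional ℂ E] (hE : ∀ x ∈ E, A x ∈ E) : E = ⊥ := by
  refine (hA E E.closed_of_finiteDimensional hE).resolve_right ?_
  rintro rfl
  exact not_finiteDimensional_l2 (Module.Finite.equiv Submodule.topEquiv)

theorem injective (hA : HasOnlyTrivialInvariant A) {v : l2} (hv : A v = 0) : v = 0 := by
  have h := hA.eq_bot_of_finiteDimensional (ℂ ∙ v) fun x hx => by
    obtain ⟨c, rfl⟩ := Submodule.mem_span_singleton.mp hx
    simp [hv]
  simpa using h

theorem exists_inner_pow_ne_zero (hA : HasOnlyTrivialInvariant A) {v w : l2} (hv : v ≠ 0)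
    (hw : w ≠ 0) : ∃ n : ℕ, 1 ≤ n ∧ ⟪(A ^ n) v, w⟫_ℂ ≠ 0 := by
  by_contra! h
  let M : Submodule ℂ l2 := ⨅ n : ℕ, (innerSL ℂ w ∘L (A ^ n)).ker
  have hM (x : l2) : x ∈ M ↔ ∀ n : ℕ, ⟪w, (A ^ n) x⟫_ℂ = 0 := by
    simp only [M, Submodule.mem_iInf]
    rfl
  have hclosed : IsClosed (M : Set l2) := by
    simp only [M, Submodule.coe_iInf]
    exact isClosed_iInter fun n => (innerSL ℂ w ∘L (A ^ n)).isClosed_ker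
  have hAv : A v ∈ M := (hM _).mpr fun n => by
    rw [← mul_apply_eq_comp, ← pow_succ]
    exact inner_eq_zero_symm.mp (h (n + 1) (by omega))
  rcases hA M hclosed fun x hx => (hM _).mpr fun n => by
    rw [← mul_apply_eq_comp, ← pow_succ]
    exact (hM x).mp hx (n + 1) with hbot | htop
  · exact hv (hA.injective (by simpa [hbot] using hAv))
  · have hw' : w ∈ M := htop ▸ Submodule.mem_top
    exact hw (by simpa using (hM w).mp hw' 0)

/-- The restriction of a strict contraction without nontrivial closed invariant subspaces to a
finite-dimensional subspace. -/
def restrict (hA : HasOnlyTrivialInvariant A) (hnorm : ‖A‖ < 1) (E : Submodule ℂ l2)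
    [FiniteDimensional ℂ E] : PartialOp where
  dom := E
  findim := inferInstance
  toFun := A ∘L E.subtypeL
  norm_lt := by
    refine lt_of_le_of_lt (ContinuousLinearMap.opNorm_le_bound _ (norm_nonneg A) fun x => ?_) hnorm
    exact A.le_opNorm x
  no_invariant E' hE' := by
    refine Submodule.map_injective_of_injective E.subtype_injective ?_
    rw [Submodule.map_bot]
    refine hA.eq_bot_of_finiteDimensional _ ?_
    rintro _ ⟨x, hx, rfl⟩
    exact hE' x hx

theorem exists_filter (hA : HasOnlyTrivialInvariant A) (hnorm : ‖A‖ < 1) :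
    ∃ G : Set PartialOp, G.Nonempty ∧
      (∀ p ∈ G, ∀ q : PartialOp, PartialOp.le p q → q ∈ G) ∧
      (∀ p ∈ G, ∀ q ∈ G, ∃ r ∈ G, PartialOp.le r p ∧ PartialOp.le r q) ∧
      (∀ v w : l2, ‖v‖ = 1 → ‖w‖ = 1 → ∃ p ∈ G, p ∈ Dvw v w) := by
  refine ⟨{p | ∀ (x : l2) (hx : x ∈ p.dom), p.toFun ⟨x, hx⟩ = A x},
    ⟨hA.restrict hnorm ⊥, fun _ _ => rfl⟩, fun p hp q hpq x hx => ?_, fun p hp q hq => ?_,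
    fun v w hv hw => ?_⟩
  · rw [← hpq.2 x hx (hpq.1 hx), hp]
  · have := p.findim
    have := q.findim
    exact ⟨hA.restrict hnorm (p.dom ⊔ q.dom), fun _ _ => rfl,
      ⟨le_sup_left (a := p.dom), fun x hx _ => (hp x hx).symm⟩,
      ⟨le_sup_right (b := q.dom), fun x hx _ => (hq x hx).symm⟩⟩
  · obtain ⟨n, hn, hne⟩ := hA.exists_inner_pow_ne_zero (v := v) (w := w)
      (norm_ne_zero_iff.mp (by simp [hv])) (norm_ne_zero_iff.mp (by simp [hw]))
    have : FiniteDimensional ℂ (Submodule.span ℂ ((fun k => (A ^ k) v) '' Set.Iio n)) :=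
      FiniteDimensional.span_of_finite ℂ ((Set.finite_Iio n).image _)
    refine ⟨hA.restrict hnorm (Submodule.span ℂ ((fun k => (A ^ k) v) '' Set.Iio n)),
      fun _ _ => rfl, n, hn, fun k => (A ^ k) v, by simp, fun k hk => ?_, hne⟩
    exact ⟨Submodule.subset_span ⟨k, hk, rfl⟩, congrArg (· v) (pow_succ' A k)⟩

end HasOnlyTrivialInvariant

theorem exists_mem_dom_of_generic {G : Set PartialOp} (hne : G.Nonempty)
    (hD : ∀ v w : l2, ‖v‖ = 1 → ‖w‖ = 1 → ∃ p ∈ G, p ∈ Dvw v w) (v : l2) :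
    ∃ p ∈ G, v ∈ p.dom := by
  rcases eq_or_ne v 0 with rfl | hv
  · obtain ⟨p, hp⟩ := hne
    exact ⟨p, hp, p.dom.zero_mem⟩
  · have hunit := norm_smul_inv_norm (𝕜 := ℂ) hv
    obtain ⟨p, hp, n, hn, u, hu, hstep, -⟩ := hD _ _ hunit hunit
    obtain ⟨hmem, -⟩ := hstep 0 hn
    rw [hu, Submodule.smul_mem_iff _ (by simpa using hv)] at hmem
    exact ⟨p, hp, hmem⟩

theorem exists_clm_extending_of_directed {G : Set PartialOp}
    (hdir : ∀ p ∈ G, ∀ q ∈ G, ∃ r ∈ G, PartialOp.le r p ∧ PartialOp.le r q)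
    (hdom : ∀ v : l2, ∃ p ∈ G, v ∈ p.dom) :
    ∃ A : l2 →L[ℂ] l2, ∀ p ∈ G, ∀ (x : l2) (hx : x ∈ p.dom), p.toFun ⟨x, hx⟩ = A x := by
  choose P hPG hP using hdom
  have key : ∀ p ∈ G, ∀ (x : l2) (hx : x ∈ p.dom),
      p.toFun ⟨x, hx⟩ = (P x).toFun ⟨x, hP x⟩ := fun p hp x hx => by
    obtain ⟨r, -, hrp, hrx⟩ := hdir p hp (P x) (hPG x)
    rw [← hrp.2 x hx (hrp.1 hx), ← hrx.2 x (hP x) (hrp.1 hx)]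
  let L : l2 →ₗ[ℂ] l2 :=
    { toFun := fun x => (P x).toFun ⟨x, hP x⟩
      map_add' := fun x y => by
        obtain ⟨r, hr, hrx, hry⟩ := hdir _ (hPG x) _ (hPG y)
        have hx := hrx.1 (hP x)
        have hy := hry.1 (hP y)
        rw [← key r hr x hx, ← key r hr y hy, ← key r hr (x + y) (r.dom.add_mem hx hy), ← map_add]
        rfl
      map_smul' := fun c x => by
        rw [← key _ (hPG x) (c • x) ((P x).dom.smul_mem c (hP x)), RingHom.id_apply, ← map_smul]
        rfl }
  exact ⟨L.mkContinuous 1 fun x => (P x).toFun.le_of_opNorm_le (P x).norm_lt.le ⟨x, hP x⟩, key⟩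

theorem hasOnlyTrivialInvariant_of_generic {G : Set PartialOp} {A : l2 →L[ℂ] l2}
    (hA : ∀ p ∈ G, ∀ (x : l2) (hx : x ∈ p.dom), p.toFun ⟨x, hx⟩ = A x)
    (hD : ∀ v w : l2, ‖v‖ = 1 → ‖w‖ = 1 → ∃ p ∈ G, p ∈ Dvw v w) :
    HasOnlyTrivialInvariant A := by
  intro E hE hinv
  by_contra! hcon
  have : CompleteSpace E := hE.completeSpace_coe
  obtain ⟨v, hvE, hv⟩ := E.exists_mem_ne_zero_of_ne_bot hcon.1
  obtain ⟨w, hwE, hw⟩ := Eᗮ.exists_mem_ne_zero_of_ne_bot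
    (mt Submodule.orthogonal_eq_bot_iff.mp hcon.2)
  obtain ⟨p, hp, n, -, u, hu, hstep, hne⟩ :=
    hD _ _ (norm_smul_inv_norm (𝕜 := ℂ) hv) (norm_smul_inv_norm (𝕜 := ℂ) hw)
  have hmem : ∀ k ≤ n, u k ∈ E := by
    intro k
    induction k with
    | zero => exact fun _ => hu ▸ E.smul_mem _ hvE
    | succ k ih =>
      intro hk
      obtain ⟨h, heq⟩ := hstep k hk
      rw [heq, hA p hp]
      exact hinv _ (ih (by omega))
  exact hne (Submodule.inner_right_of_mem_orthogonal (hmem n le_rfl) (Eᗮ.smul_mem _ hwE))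

/-- There is a bounded operator on `ℓ²` whose only closed invariant subspaces are `{0}`
and `ℓ²` if and only if there is a filter on the poset `P` meeting every set `D_{v,w}`
for unit vectors `v, w ∈ ℓ²`. -/
theorem isp_iff_generic_filter :
    (∃ A : l2 →L[ℂ] l2, ∀ E : Submodule ℂ l2, IsClosed (E : Set l2) →
        (∀ x ∈ E, A x ∈ E) → E = ⊥ ∨ E = ⊤) ↔
    (∃ G : Set PartialOp, G.Nonempty ∧
      (∀ p ∈ G, ∀ q : PartialOp, PartialOp.le p q → q ∈ G) ∧
      (∀ p ∈ G, ∀ q ∈ G, ∃ r ∈ G, PartialOp.le r p ∧ PartialOp.le r q) ∧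
      (∀ v w : l2, ‖v‖ = 1 → ‖w‖ = 1 → ∃ p ∈ G, p ∈ Dvw v w)) := by
  constructor
  · rintro ⟨A, hA⟩
    obtain ⟨B, hB, hnorm⟩ := HasOnlyTrivialInvariant.exists_norm_lt_one hA
    exact hB.exists_filter hnorm
  · rintro ⟨G, hne, -, hdir, hD⟩
    obtain ⟨A, hA⟩ := exists_clm_extending_of_directed hdir (exists_mem_dom_of_generic hne hD)
    exact ⟨A, hasOnlyTrivialInvariant_of_generic hA hD⟩
end
end
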